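/- Define H₂(x) = −x · log x / log 2 − (1−x) · log(1−x) / log 2 (binary entropy base 2) and r₁(p,q) = 1 − H₂(p + q − 2pq) + H₂( (1 − √(1 − 16 p (1−p) q (1−q)))/2 ) − H₂(p). Then at p = 23/200: (i) 1 − 2·H₂(23/200) < 0, while (ii) r₁(23/200, 3/10) > 0. That is, at bit error rate 0.115 the noiseless random-coding (Shor–Preskill) rate 1 − 2H₂(p) is negative, whereas the noisy-processing rate is positive. -/

import Mathlib

/-- Binary entropy, base 2: `H₂(x) = −x log₂ x − (1−x) log₂ (1−x)`. -/
noncomputable def H2 (x : ℝ) : ℝ :=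
  -x * Real.log x / Real.log 2 - (1 - x) * Real.log (1 - x) / Real.log 2

/-- The `m = 1` key rate of BB84 with noisy processing at bit error rate `p` and added
noise rate `q`:
`r₁(p,q) = 1 − H₂(p + q − 2pq) + H₂((1 − √(1 − 16p(1−p)q(1−q)))/2) − H₂(p)`. -/
noncomputable def keyRate1 (p q : ℝ) : ℝ :=
  1 - H2 (p + q - 2 * p * q) +
    H2 ((1 - Real.sqrt (1 - 16 * p * (1 - p) * q * (1 - q))) / 2) - H2 p

theorem H2_eq_binEntropy_div (x : ℝ) : H2 x = Real.binEntropy x / Real.log 2 := by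
  rw [H2, Real.binEntropy_eq_negMulLog_add_negMulLog_one_sub, Real.negMulLog, Real.negMulLog]
  ring

theorem H2_le_H2 {x y : ℝ} (hx : 0 ≤ x) (hxy : x ≤ y) (hy : y ≤ 1 / 2) : H2 x ≤ H2 y := by
  rw [H2_eq_binEntropy_div, H2_eq_binEntropy_div]
  have hlog : 0 < Real.log 2 := Real.log_pos one_lt_two
  gcongr
  exact Real.binEntropy_strictMonoOn.monotoneOn ⟨hx, by linarith⟩ ⟨by linarith, by linarith⟩ hxy

theorem log_mul_two_pow {x : ℝ} (hx : 0 < x) (m n : ℕ) :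
    Real.log (x ^ n * 2 ^ m) = n * Real.log x + m * Real.log 2 := by
  rw [Real.log_mul (by positivity) (by positivity), Real.log_pow, Real.log_pow]

theorem neg_log_div_log_two_le {x : ℝ} (hx : 0 < x) {m n : ℕ} (hn : 0 < n)
    (h : 1 ≤ x ^ n * 2 ^ m) : -(Real.log x / Real.log 2) ≤ m / n := by
  have hlog : 0 < Real.log 2 := Real.log_pos one_lt_two
  have hn' : (0 : ℝ) < n := by exact_mod_cast hn
  have := Real.log_nonneg h
  rw [log_mul_two_pow hx] at this
  rw [← neg_div, div_le_div_iff₀ hlog hn']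
  linarith

theorem le_neg_log_div_log_two {x : ℝ} (hx : 0 < x) {m n : ℕ} (hn : 0 < n)
    (h : x ^ n * 2 ^ m ≤ 1) : (m / n : ℝ) ≤ -(Real.log x / Real.log 2) := by
  have hlog : 0 < Real.log 2 := Real.log_pos one_lt_two
  have hn' : (0 : ℝ) < n := by exact_mod_cast hn
  have := Real.log_nonpos (by positivity) h
  rw [log_mul_two_pow hx] at this
  rw [← neg_div, div_le_div_iff₀ hn' hlog]
  linarith

theorem H2_eq_mul_add_mul (x : ℝ) :
    H2 x = x * -(Real.log x / Real.log 2) + (1 - x) * -(Real.log (1 - x) / Real.log 2) := by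
  rw [H2]
  ring

theorem H2_le_of_one_le {x : ℝ} (hx : 0 < x) (hx' : x < 1) (m n k l : ℕ) (hn : 0 < n)
    (hl : 0 < l) (h : 1 ≤ x ^ n * 2 ^ m) (h' : 1 ≤ (1 - x) ^ l * 2 ^ k) :
    H2 x ≤ x * (m / n) + (1 - x) * (k / l) := by
  rw [H2_eq_mul_add_mul]
  have hy : 0 < 1 - x := by linarith
  exact add_le_add (mul_le_mul_of_nonneg_left (neg_log_div_log_two_le hx hn h) hx.le)
    (mul_le_mul_of_nonneg_left (neg_log_div_log_two_le hy hl h') hy.le)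

theorem le_H2_of_le_one {x : ℝ} (hx : 0 < x) (hx' : x < 1) (m n k l : ℕ) (hn : 0 < n)
    (hl : 0 < l) (h : x ^ n * 2 ^ m ≤ 1) (h' : (1 - x) ^ l * 2 ^ k ≤ 1) :
    x * (m / n) + (1 - x) * (k / l) ≤ H2 x := by
  rw [H2_eq_mul_add_mul]
  have hy : 0 < 1 - x := by linarith
  exact add_le_add (mul_le_mul_of_nonneg_left (le_neg_log_div_log_two hx hn h) hx.le)
    (mul_le_mul_of_nonneg_left (le_neg_log_div_log_two hy hl h') hy.le)

set_option exponentiation.threshold 600 in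
/-- At bit error rate `p = 0.115` the noiseless Shor–Preskill rate `1 − 2H₂(p)` is
negative, whereas the noisy-processing rate `r₁(p, 0.3)` is positive. -/
theorem noisy_processing_beats_shor_preskill :
    1 - 2 * H2 (23 / 200) < 0 ∧ keyRate1 (23 / 200) (3 / 10) > 0 := by
  constructor
  · have h := le_H2_of_le_one (x := 23 / 200) (by norm_num) (by norm_num) 493 158 25 142
      (by norm_num) (by norm_num) (by norm_num) (by norm_num)
    norm_num at h ⊢
    linarith
  · have hp := H2_le_of_one_le (x := 23 / 200) (by norm_num) (by norm_num) 259 83 3 17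
      (by norm_num) (by norm_num) (by norm_num) (by norm_num)
    have hpq := H2_le_of_one_le (x := 173 / 500) (by norm_num) (by norm_num) 49 32 87 142
      (by norm_num) (by norm_num) (by norm_num) (by norm_num)
    have hs := le_H2_of_le_one (x := 47 / 500) (by norm_num) (by norm_num) 307 90 28 197
      (by norm_num) (by norm_num) (by norm_num) (by norm_num)
    have hsqrt : Real.sqrt (1 - 16 * (23 / 200) * (1 - 23 / 200) * (3 / 10) * (1 - 3 / 10))
        ≤ 203 / 250 := Real.sqrt_le_iff.mpr (by norm_num)
    have hmono := H2_le_H2 (x := 47 / 500)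
      (y := (1 - Real.sqrt (1 - 16 * (23 / 200) * (1 - 23 / 200) * (3 / 10) * (1 - 3 / 10))) / 2)
      (by norm_num) (by linarith)
      (by linarith [Real.sqrt_nonneg (1 - 16 * (23 / 200) * (1 - 23 / 200) * (3 / 10) *
        (1 - 3 / 10))])
    have harg : (23 / 200 + 3 / 10 - 2 * (23 / 200) * (3 / 10) : ℝ) = 173 / 500 := by norm_num
    rw [keyRate1, harg]
    push_cast at hp hpq hs
    linarith
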